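/- For all n ∈ ℤ the Toeplitz matrix elements w_n of the diagonal correlations of the square-lattice Ising model satisfy the second-order linear homogeneous recurrence α(2n−3)·w_{n−2} − 2·((α²+1)n−1)·w_{n−1} + α(2n+1)·w_n = 0, where α = 1/k. -/

import Mathlib

open MeasureTheory

/-- The radicand `1 - 2 k cos θ + k²` is positive away from `k = ±1`. -/
lemma one_sub_two_mul_cos_add_sq_pos {k : ℝ} (hk1 : k ≠ 1) (hk1' : k ≠ -1) (θ : ℝ) :
    0 < 1 - 2*k*Real.cos θ + k^2 := by
  have h : 1 - 2*k*Real.cos θ + k^2 = (k - Real.cos θ)^2 + Real.sin θ^2 := by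
    linear_combination -Real.sin_sq_add_cos_sq θ
  rw [h]
  refine lt_of_le_of_ne (by positivity) fun h0 => ?_
  have hs : Real.sin θ = 0 := by
    nlinarith [sq_nonneg (k - Real.cos θ), sq_nonneg (Real.sin θ)]
  have hc : k = Real.cos θ := by
    nlinarith [sq_nonneg (k - Real.cos θ), sq_nonneg (Real.sin θ)]
  rcases Real.sin_eq_zero_iff_cos_eq.mp hs with h1 | h1
  · exact hk1 (hc.trans h1)
  · exact hk1' (hc.trans h1)

/-- The integrand of the Toeplitz matrix element with real index `x`. -/
noncomputable def toeplitzIntegrand (k x θ : ℝ) : ℝ :=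
  (k * Real.cos (x*θ) - Real.cos ((x+1)*θ)) / Real.sqrt (1 - 2*k*Real.cos θ + k^2)

lemma continuous_toeplitzIntegrand {k : ℝ} (hk1 : k ≠ 1) (hk1' : k ≠ -1) (x : ℝ) :
    Continuous (toeplitzIntegrand k x) := by
  unfold toeplitzIntegrand
  refine Continuous.div (by fun_prop) (by fun_prop) fun θ => ?_
  exact (Real.sqrt_pos.mpr (one_sub_two_mul_cos_add_sq_pos hk1 hk1' θ)).ne'

/-- The combination of integrands in the recurrence has an elementary antiderivative. -/
lemma hasDerivAt_toeplitz_antideriv {k : ℝ} (hk1 : k ≠ 1) (hk1' : k ≠ -1) (x θ : ℝ) :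
    HasDerivAt
      (fun θ => -2 * (Real.sqrt (1 - 2*k*Real.cos θ + k^2) *
        (k * Real.sin ((x-1)*θ) - Real.sin (x*θ))))
      (k*(2*x-3) * toeplitzIntegrand k (x-2) θ
        - 2*((1+k^2)*x - k^2) * toeplitzIntegrand k (x-1) θ
        + k*(2*x+1) * toeplitzIntegrand k x θ) θ := by
  have hD := one_sub_two_mul_cos_add_sq_pos hk1 hk1' θ
  have hlin (c : ℝ) : HasDerivAt (fun θ : ℝ => c*θ) c θ := by
    simpa using (hasDerivAt_id θ).const_mul c
  have hrad : HasDerivAt (fun θ => 1 - 2*k*Real.cos θ + k^2) (2*k*Real.sin θ) θ := by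
    simpa using (((Real.hasDerivAt_cos θ).const_mul (2*k)).const_sub 1).add_const (k^2)
  have hder := ((hrad.sqrt hD.ne').mul
    (((hlin (x-1)).sin.const_mul k).sub (hlin x).sin)).const_mul (-2)
  refine hder.congr_deriv ?_
  have hs := (Real.sqrt_pos.mpr hD).ne'
  have hsq := Real.sq_sqrt hD.le
  have e0 : (x-2)*θ = (x-1)*θ - θ := by ring
  have e1 : (x-2+1)*θ = (x-1)*θ := by ring
  have e2 : (x-1+1)*θ = (x-1)*θ + θ := by ring
  have e3 : x*θ = (x-1)*θ + θ := by ring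
  have e4 : (x+1)*θ = (x-1)*θ + θ + θ := by ring
  simp only [Pi.sub_apply, toeplitzIntegrand, e0, e1, e2, e3, e4]
  generalize (x-1)*θ = a
  generalize Real.sqrt (1 - 2*k*Real.cos θ + k^2) = r at hs hsq ⊢
  simp only [Real.cos_add, Real.sin_add, Real.cos_sub]
  have hp := Real.sin_sq_add_cos_sq θ
  generalize Real.cos θ = c at *
  generalize Real.sin θ = s at *
  generalize Real.cos a = C
  generalize Real.sin a = S
  field_simp
  rw [hsq]
  have hs2 : s^2 = 1 - c^2 := by linear_combination hp
  ring_nf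
  simp only [hs2]
  ring

/-- The second-order linear recurrence satisfied by the Toeplitz matrix elements of
the diagonal correlations of the square-lattice Ising model, with `α = 1/k`. -/
theorem stmt3 (k : ℝ) (hk0 : k ≠ 0) (hk1 : k ≠ 1) (hk1' : k ≠ -1)
    (α : ℝ) (hα : α = 1/k)
    (w : ℤ → ℝ)
    (hw : ∀ n : ℤ, w n = (1/(2*Real.pi)) *
      ∫ θ in (-Real.pi)..Real.pi,
        (k * Real.cos ((n:ℝ)*θ) - Real.cos (((n:ℝ)+1)*θ)) /
          Real.sqrt (1 - 2*k*Real.cos θ + k^2)) :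
    ∀ n : ℤ,
      α*(2*(n:ℝ)-3) * w (n-2) - 2*((α^2+1)*(n:ℝ) - 1) * w (n-1) + α*(2*(n:ℝ)+1) * w n = 0 := by
  intro n
  have hint (x : ℝ) : IntervalIntegrable (toeplitzIntegrand k x) volume (-Real.pi) Real.pi :=
    (continuous_toeplitzIntegrand hk1 hk1' x).intervalIntegrable _ _
  have hw' (m : ℤ) : w m = (1/(2*Real.pi)) *
      ∫ θ in (-Real.pi)..Real.pi, toeplitzIntegrand k m θ := hw m
  have i0 := (hint (n-2)).const_mul (k*(2*n-3))
  have i1 := (hint (n-1)).const_mul (2*((1+k^2)*n - k^2))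
  have i2 := (hint n).const_mul (k*(2*n+1))
  have hsin : Real.sin (((n:ℝ)-1)*Real.pi) = 0 := by
    exact_mod_cast Real.sin_int_mul_pi (n-1)
  have key := intervalIntegral.integral_eq_sub_of_hasDerivAt
    (fun θ _ => hasDerivAt_toeplitz_antideriv hk1 hk1' (n:ℝ) θ) ((i0.sub i1).add i2)
  rw [intervalIntegral.integral_add (i0.sub i1) i2, intervalIntegral.integral_sub i0 i1] at key
  simp only [intervalIntegral.integral_const_mul, mul_neg, Real.sin_neg, hsin,
    Real.sin_int_mul_pi, mul_zero, neg_zero, sub_zero] at key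
  rw [hw' (n-2), hw' (n-1), hw' n, hα]
  push_cast
  field_simp
  linear_combination key
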